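/- Let d = 1, p = p_c, ε ∈ (0,1), t ≥ 1, and let w ≥ 2 be an integer such that V_{p_c}(w,3t) ≥ ε and H_{p_c}(3w,t) ≥ ε. Then χ_t ≥ (1/2)·ε⁶·w·θ_t². -/

import Mathlib

/-!
Common set-up: nearest-neighbour oriented bond percolation on the space-time
lattice `ℤ^d × ℕ`.  A (potential) bond is a pair `((x, s), y)`, representing
the oriented bond from `(x, s)` to `(y, s + 1)` (it is a genuine bond when
`‖x - y‖₁ = 1`).  Each bond is occupied (`true`) with probability `p`,
independently of all other bonds.  The product Bernoulli(`p`) measure on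
configurations is constructed explicitly as the pushforward of the uniform
measure on `[0,1)`: the binary digits of a uniform sample are i.i.d. fair
coin flips, which are re-packed (via the pairing function) into an i.i.d.
sequence of uniform random variables `unif i`, one for each bond, and the
bond indexed by `i` is occupied exactly when `unif i < p`.
-/

open MeasureTheory Filter Set
open scoped Classical ENNReal Topology

namespace OrientedPercolation

/-- A potential bond of the `d`-dimensional space-time lattice: `((x, s), y)`
represents the oriented pair from `(x, s)` to `(y, s + 1)`. -/
abbrev Bond (d : ℕ) := ((Fin d → ℤ) × ℕ) × (Fin d → ℤ)

/-- A bond configuration: each potential bond is occupied (`true`) or vacant (`false`). -/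
abbrev Config (d : ℕ) := Bond d → Bool

/-- The ℓ¹-norm of a point of `ℤ^d`. -/
def norm1 {d : ℕ} (x : Fin d → ℤ) : ℤ := ∑ i, |x i|

/-- The squared Euclidean norm of a point of `ℤ^d`. -/
def normSq {d : ℕ} (x : Fin d → ℤ) : ℤ := ∑ i, (x i) ^ 2

/-- The `n`-th binary digit of `x ∈ [0,1)`. -/
noncomputable def digit (n : ℕ) (x : ℝ) : ℕ := ⌊x * 2 ^ (n + 1)⌋.toNat % 2

/-- From a single uniform sample on `[0,1)`, an i.i.d. sequence of uniform
samples on `[0,1]`, obtained by splitting the binary digits via the pairing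
function. -/
noncomputable def unif (i : ℕ) (x : ℝ) : ℝ :=
  ∑' k : ℕ, (digit (Nat.pair i k) x : ℝ) / 2 ^ (k + 1)

/-- An injective encoding of the bonds by natural numbers. -/
noncomputable def enc (d : ℕ) : Bond d → ℕ := (exists_injective_nat (Bond d)).choose

/-- The i.i.d. Bernoulli(`p`) bond configuration built from a uniform sample `x`. -/
noncomputable def config (d : ℕ) (p : ℝ) (x : ℝ) : Config d :=
  fun b => if unif (enc d b) x < p then true else false

/-- The product Bernoulli(`p`) measure `ℙ_p` on bond configurations. -/
noncomputable def P (d : ℕ) (p : ℝ) : Measure (Config d) :=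
  Measure.map (config d p) ((volume : Measure ℝ).restrict (Set.Ico 0 1))

/-- `ConnectedIn ω R x s y t` : either `(x,s) = (y,t) ∈ R`, or there is a path of
occupied bonds from `(x, s)` to `(y, t)`, all of whose vertices lie in `R`. -/
def ConnectedIn {d : ℕ} (ω : Config d) (R : Set ((Fin d → ℤ) × ℕ))
    (x : Fin d → ℤ) (s : ℕ) (y : Fin d → ℤ) (t : ℕ) : Prop :=
  (x = y ∧ s = t ∧ (x, s) ∈ R) ∨
  (s < t ∧ ∃ v : ℕ → (Fin d → ℤ), v s = x ∧ v t = y ∧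
    (∀ j, s ≤ j → j ≤ t → (v j, j) ∈ R) ∧
    (∀ j, s ≤ j → j < t → norm1 (v (j + 1) - v j) = 1 ∧ ω ((v j, j), v (j + 1)) = true))

/-- `(x, s) → (y, t)` : `(x,s) = (y,t)` or there is a path of occupied bonds from
`(x, s)` to `(y, t)`. -/
def Connected {d : ℕ} (ω : Config d) (x : Fin d → ℤ) (s : ℕ) (y : Fin d → ℤ) (t : ℕ) : Prop :=
  ConnectedIn ω Set.univ x s y t

/-- The survival probability `θ_t = ℙ_p((o,0) → t)`. -/
noncomputable def theta (d : ℕ) (p : ℝ) (t : ℕ) : ℝ :=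
  (P d p {ω | ∃ y, Connected ω 0 0 y t}).toReal

/-- The two-point function `τ(x,t) = ℙ_p((o,0) → (x,t))`. -/
noncomputable def tau (d : ℕ) (p : ℝ) (x : Fin d → ℤ) (t : ℕ) : ℝ :=
  (P d p {ω | Connected ω 0 0 x t}).toReal

/-- The expected number of vertices at time `t` connected from the origin,
`χ_t = Σ_x τ(x,t)`. -/
noncomputable def chi (d : ℕ) (p : ℝ) (t : ℕ) : ℝ := ∑' x : Fin d → ℤ, tau d p x t

/-- The gyration radius `ξ_t = (χ_t⁻¹ Σ_x |x|² τ(x,t))^(1/2)`. -/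
noncomputable def xi (d : ℕ) (p : ℝ) (t : ℕ) : ℝ :=
  Real.sqrt ((∑' x : Fin d → ℤ, (normSq x : ℝ) * tau d p x t) / chi d p t)

/-- The critical point `p_c = inf {p ∈ [0,1] : θ_∞ > 0}` (here `θ_∞ = lim_t θ_t = inf_t θ_t`,
since `θ_t` is nonincreasing in `t` and nonnegative). -/
noncomputable def pc (d : ℕ) : ℝ :=
  sInf {p ∈ Set.Icc (0 : ℝ) 1 | 0 < ⨅ t : ℕ, theta d p t}

/-- The rectangle `[a, b] × [0, t]` (for `d = 1`). -/
def rect (a b : ℤ) (t : ℕ) : Set ((Fin 1 → ℤ) × ℕ) :=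
  {v | a ≤ v.1 0 ∧ v.1 0 ≤ b ∧ v.2 ≤ t}

/-- The rectangle `[a, b] × [0, t]` is crossed vertically: there is a path of occupied
bonds inside the rectangle from some vertex `(x, 0)` to some vertex `(y, t)`. -/
def CrossedVert (ω : Config 1) (a b : ℤ) (t : ℕ) : Prop :=
  ∃ x y : Fin 1 → ℤ, ConnectedIn ω (rect a b t) x 0 y t

/-- The rectangle `[a, b] × [0, t]` is crossed from left to right: there is a path of
occupied bonds inside the rectangle containing a vertex with first coordinate `a` and
a vertex with first coordinate `b`. -/
def CrossedHoriz (ω : Config 1) (a b : ℤ) (t : ℕ) : Prop :=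
  ∃ (x y : Fin 1 → ℤ) (s u : ℕ), x 0 = a ∧ y 0 = b ∧
    (ConnectedIn ω (rect a b t) x s y u ∨ ConnectedIn ω (rect a b t) y u x s)

/-- `V_p(w, t) = ℙ_p([0,w] × [0,t] is crossed vertically)`. -/
noncomputable def V (p : ℝ) (w : ℕ) (t : ℕ) : ℝ :=
  (P 1 p {ω | CrossedVert ω 0 w t}).toReal

/-- `H_p(w, t) = ℙ_p([0,w] × [0,t] is crossed from left to right)`. -/
noncomputable def H (p : ℝ) (w : ℕ) (t : ℕ) : ℝ :=
  (P 1 p {ω | CrossedHoriz ω 0 w t}).toReal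

/-- The event that `(o, 0)` is connected, inside the box `B_o = [-w,w] × [0,t]`, to the
boundary `∂B_o = {(x,s) ∈ B_o : s = t or |x| = w}`. -/
def ToBoundary (ω : Config 1) (w : ℕ) (t : ℕ) : Prop :=
  ∃ (y : Fin 1 → ℤ) (s : ℕ), (s = t ∨ |y 0| = w) ∧
    ConnectedIn ω (rect (-(w : ℤ)) w t) 0 0 y s


/-! ### The digits are i.i.d. fair coins -/

/-- The uniform measure on `[0,1)`. -/
noncomputable def unitU : Measure ℝ := (volume : Measure ℝ).restrict (Set.Ico 0 1)

instance unitU_prob : IsProbabilityMeasure unitU := ⟨by simp [unitU]⟩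

/-- A fair coin with values in `ℕ`. -/
noncomputable def coin : Measure ℕ := (2⁻¹ : ℝ≥0∞) • (Measure.dirac 0 + Measure.dirac 1)

instance coin_prob : IsProbabilityMeasure coin := ⟨by
  simp only [coin, Measure.smul_apply, Measure.add_apply, measure_univ, smul_eq_mul]
  rw [one_add_one_eq_two]
  exact ENNReal.inv_mul_cancel (by simp) (by simp)⟩

lemma measurable_digit (n : ℕ) : Measurable (digit n) := by
  unfold digit
  have h1 : Measurable (fun x : ℝ => ⌊x * 2 ^ (n + 1)⌋) :=
    Int.measurable_floor.comp (measurable_id.mul_const _)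
  exact (measurable_from_top (f := fun z : ℤ => z.toNat % 2)).comp h1

lemma digit_lo (x : ℝ) (n : ℕ) : digit (n + 1) x = digit n (2 * x) := by
  unfold digit
  congr 3
  ring_nf

lemma digit_hi (x : ℝ) (hx : 2⁻¹ ≤ x) (n : ℕ) : digit (n + 1) x = digit n (2 * x - 1) := by
  unfold digit
  have h : x * 2 ^ (n + 1 + 1) = (2 * x - 1) * 2 ^ (n + 1) + ((2 ^ (n + 1) : ℕ) : ℤ) := by
    push_cast; ring
  rw [h, Int.floor_add_intCast]
  have h0 : 0 ≤ ⌊(2 * x - 1) * 2 ^ (n + 1)⌋ := by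
    apply Int.floor_nonneg.2
    have : 0 ≤ 2 * x - 1 := by linarith
    positivity
  obtain ⟨k, hk⟩ := Int.eq_ofNat_of_zero_le h0
  rw [hk]
  have : ((k : ℤ) + ((2 ^ (n + 1) : ℕ) : ℤ)).toNat = k + 2 ^ (n + 1) := by
    rw [← Nat.cast_add, Int.toNat_natCast]
  rw [this]
  simp only [Int.toNat_natCast]
  rw [pow_succ]; omega

lemma digit_zero_lo (x : ℝ) (h0 : 0 ≤ x) (hx : x < 2⁻¹) : digit 0 x = 0 := by
  unfold digit
  have : ⌊x * 2 ^ (0 + 1)⌋ = 0 := by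
    rw [Int.floor_eq_iff]; norm_num; constructor <;> linarith
  rw [this]; simp

lemma digit_zero_hi (x : ℝ) (h0 : 2⁻¹ ≤ x) (hx : x < 1) : digit 0 x = 1 := by
  unfold digit
  have : ⌊x * 2 ^ (0 + 1)⌋ = 1 := by
    rw [Int.floor_eq_iff]; norm_num; constructor <;> linarith
  rw [this]; simp

lemma scale_lo (B : Set ℝ) :
    volume {x : ℝ | 2 * x ∈ B} = 2⁻¹ * volume B := by
  have := Real.volume_preimage_mul_left (a := 2) (by norm_num) B
  rw [show ((fun x : ℝ => 2 * x) ⁻¹' B) = {x : ℝ | 2 * x ∈ B} from rfl] at this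
  rw [this]
  congr 1
  rw [abs_of_pos (by norm_num), ENNReal.ofReal_inv_of_pos (by norm_num)]
  simp

lemma scale_hi (B : Set ℝ) :
    volume {x : ℝ | 2 * x - 1 ∈ B} = 2⁻¹ * volume B := by
  have h := scale_lo ((fun y : ℝ => y + (-1)) ⁻¹' B)
  rw [measure_preimage_add_right] at h
  rw [← h]
  rfl

lemma digits_box (n : ℕ) : ∀ t : ℕ → Set ℕ,
    unitU {x | ∀ i < n, digit i x ∈ t i} = ∏ i ∈ Finset.range n, coin (t i) := by
  induction n with
  | zero => intro t; simp
  | succ n ih =>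
    intro t
    rw [Finset.prod_range_succ', ← ih (fun i => t (i + 1))]
    set C : Set ℝ := {x | ∀ i < n, digit i x ∈ t (i + 1)} with hC
    have mC : MeasurableSet C := by
      have : C = ⋂ i, ⋂ (_ : i < n), digit i ⁻¹' t (i + 1) := by ext; simp [hC]
      rw [this]
      exact MeasurableSet.iInter fun i => MeasurableSet.iInter fun _ =>
        measurable_digit i (MeasurableSet.of_discrete)
    have mD : MeasurableSet {x | ∀ i < n + 1, digit i x ∈ t i} := by
      have : {x | ∀ i < n + 1, digit i x ∈ t i} = ⋂ i, ⋂ (_ : i < n + 1), digit i ⁻¹' t i := by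
        ext; simp
      rw [this]
      exact MeasurableSet.iInter fun i => MeasurableSet.iInter fun _ =>
        measurable_digit i (MeasurableSet.of_discrete)
    have e1 : {x | ∀ i < n + 1, digit i x ∈ t i} ∩ Set.Ico 0 2⁻¹ =
        {x : ℝ | 2 * x ∈ C ∩ Set.Ico 0 1} ∩ {_x | 0 ∈ t 0} := by
      ext x
      simp only [hC, Set.mem_inter_iff, Set.mem_ofPred_eq, Set.mem_Ico]
      constructor
      · rintro ⟨h, h0, h1⟩
        refine ⟨⟨fun i hi => ?_, by linarith, by linarith⟩, ?_⟩
        · rw [← digit_lo]; exact h _ (by omega)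
        · have := h 0 (by omega); rwa [digit_zero_lo x h0 h1] at this
      · rintro ⟨⟨h, h0, h1⟩, h2⟩
        refine ⟨fun i hi => ?_, by linarith, by linarith⟩
        rcases i with _ | i
        · rwa [digit_zero_lo x (by linarith) (by linarith)]
        · rw [digit_lo]; exact h _ (by omega)
    have e2 : {x | ∀ i < n + 1, digit i x ∈ t i} ∩ Set.Ico 2⁻¹ 1 =
        {x : ℝ | 2 * x - 1 ∈ C ∩ Set.Ico 0 1} ∩ {_x | 1 ∈ t 0} := by
      ext x
      simp only [hC, Set.mem_inter_iff, Set.mem_ofPred_eq, Set.mem_Ico]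
      constructor
      · rintro ⟨h, h0, h1⟩
        refine ⟨⟨fun i hi => ?_, by linarith, by linarith⟩, ?_⟩
        · rw [← digit_hi x h0]; exact h _ (by omega)
        · have := h 0 (by omega); rwa [digit_zero_hi x h0 h1] at this
      · rintro ⟨⟨h, h0, h1⟩, h2⟩
        refine ⟨fun i hi => ?_, by linarith, by linarith⟩
        rcases i with _ | i
        · rwa [digit_zero_hi x (by linarith) (by linarith)]
        · rw [digit_hi x (by linarith)]; exact h _ (by omega)
    have hs : Set.Ico (0:ℝ) 1 = Set.Ico 0 2⁻¹ ∪ Set.Ico 2⁻¹ 1 :=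
      (Set.Ico_union_Ico_eq_Ico (by norm_num) (by norm_num)).symm
    have hd : Disjoint ({x | ∀ i < n + 1, digit i x ∈ t i} ∩ Set.Ico 0 2⁻¹)
        ({x | ∀ i < n + 1, digit i x ∈ t i} ∩ Set.Ico 2⁻¹ 1) := by
      rw [Set.disjoint_left]
      rintro x ⟨_, _, h⟩ ⟨_, h', _⟩
      linarith
    rw [unitU, Measure.restrict_apply mD, Measure.restrict_apply mC, hs, Set.inter_union_distrib_left,
      measure_union hd (mD.inter measurableSet_Ico), e1, e2, ← hs]
    have hc : coin (t 0) = 2⁻¹ * ((if 0 ∈ t 0 then 1 else 0) + (if 1 ∈ t 0 then 1 else 0)) := by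
      simp only [coin, Measure.smul_apply, Measure.add_apply, smul_eq_mul,
        Measure.dirac_apply, Set.indicator_apply, Pi.one_apply]
    rw [hc]
    by_cases c0 : 0 ∈ t 0 <;> by_cases c1 : 1 ∈ t 0 <;>
      simp only [c0, c1, Set.ofPred_true, Set.ofPred_false, Set.inter_univ, Set.inter_empty,
        measure_empty, scale_lo, scale_hi, if_true, if_false] <;> ring

lemma digits_law : unitU.map (fun x n => digit n x) = Measure.infinitePi (fun _ : ℕ => coin) := by
  apply Measure.eq_infinitePi
  intro s t ht
  rw [Measure.map_apply (measurable_pi_lambda _ measurable_digit)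
    (.pi s.countable_toSet fun _ _ => ht _)]
  obtain ⟨n, hn⟩ := s.exists_nat_subset_range
  have h := digits_box n (fun i => if i ∈ s then t i else Set.univ)
  have e : ((fun x n => digit n x) ⁻¹' (s : Set ℕ).pi t) =
      {x | ∀ i < n, digit i x ∈ (if i ∈ s then t i else Set.univ)} := by
    ext x
    simp only [Set.mem_preimage, Set.mem_pi, Finset.mem_coe, Set.mem_ofPred_eq]
    constructor
    · intro h i _
      split_ifs with hi
      · exact h i hi
      · trivial
    · intro h i hi
      have := h i (Finset.mem_range.1 (hn hi))
      rwa [if_pos hi] at this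
  rw [e, h]
  rw [← Finset.prod_subset hn]
  · exact Finset.prod_congr rfl fun i hi => by rw [if_pos hi]
  · intro i _ hi; rw [if_neg hi]; exact measure_univ

/-- Threshold map turning a digit sequence into a bond state. -/
noncomputable def thr (p : ℝ) (c : ℕ → ℕ) : Bool :=
  if (∑' k : ℕ, ((c k % 2 : ℕ) : ℝ) / 2 ^ (k + 1)) < p then true else false

lemma measurable_thr (p : ℝ) : Measurable (thr p) := by
  have hs : ∀ c : ℕ → ℕ, Summable (fun k : ℕ => ((c k % 2 : ℕ) : ℝ) / 2 ^ (k + 1)) := by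
    intro c
    refine Summable.of_nonneg_of_le (fun k => by positivity) (fun k => ?_)
      (summable_geometric_two)
    have h1 : ((c k % 2 : ℕ) : ℝ) ≤ 1 := by
      have : c k % 2 ≤ 1 := by omega
      exact_mod_cast this
    rw [one_div, inv_pow, pow_succ]
    rw [div_le_iff₀ (by positivity)]
    have : (0:ℝ) < 2 ^ k := by positivity
    field_simp
    linarith
  have hm : Measurable (fun c : ℕ → ℕ => ∑' k : ℕ, ((c k % 2 : ℕ) : ℝ) / 2 ^ (k + 1)) := by
    refine measurable_of_tendsto_metrizable (f := fun n (c : ℕ → ℕ) =>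
      ∑ k ∈ Finset.range n, ((c k % 2 : ℕ) : ℝ) / 2 ^ (k + 1)) (fun n => ?_) ?_
    · refine Finset.measurable_sum _ fun k _ => ?_
      exact ((measurable_from_top (f := fun z : ℕ => ((z % 2 : ℕ) : ℝ))).comp
        (measurable_pi_apply k)).div_const _
    · rw [tendsto_pi_nhds]
      intro c
      exact (hs c).hasSum.tendsto_sum_nat
  unfold thr
  exact Measurable.ite (measurableSet_lt hm measurable_const) measurable_const measurable_const

/-- The single-bond law. -/
noncomputable def bern (p : ℝ) : Measure Bool :=
  (Measure.infinitePi (fun _ : ℕ => coin)).map (thr p)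

instance bern_prob (p : ℝ) : IsProbabilityMeasure (bern p) :=
  Measure.isProbabilityMeasure_map (measurable_thr p).aemeasurable

lemma P_eq (d : ℕ) (p : ℝ) : P d p = Measure.infinitePi (fun _ : Bond d => bern p) := by
  have hinj : Function.Injective (fun q : Bond d × ℕ => Nat.pair (enc d q.1) q.2) := by
    rintro ⟨b, k⟩ ⟨b', k'⟩ h
    have := Nat.pair_eq_pair.1 h
    have he := (exists_injective_nat (Bond d)).choose_spec this.1
    simp only [Prod.mk.injEq]
    exact ⟨he, this.2⟩
  have h1 := Measure.map_infinitePi_infinitePi_of_inj (P := fun _ : ℕ => coin) hinj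
  have h2 := Measure.infinitePi_map_curry (fun (_ : Bond d) (_ : ℕ) => coin)
  have h3 := Measure.infinitePi_map_pi (fun (_ : Bond d) => Measure.infinitePi (fun _ : ℕ => coin))
    (f := fun _ => thr p) (fun _ => measurable_thr p)
  have hc : config d p = (fun (x : Bond d → ℕ → ℕ) i => thr p (x i)) ∘
      (MeasurableEquiv.curry (Bond d) ℕ ℕ) ∘
      (fun (ω : ℕ → ℕ) (q : Bond d × ℕ) => ω (Nat.pair (enc d q.1) q.2)) ∘
      (fun x n => digit n x) := by
    funext x b
    simp only [config, unif, thr, Function.comp, MeasurableEquiv.curry, MeasurableEquiv.coe_mk,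
      Equiv.curry_apply, Function.curry]
    have : ∀ n, digit n x % 2 = digit n x := fun n => by unfold digit; omega
    simp only [this]
    congr
  have m1 : Measurable (fun (x : ℝ) n => digit n x) := measurable_pi_lambda _ measurable_digit
  have m2 : Measurable (fun (ω : ℕ → ℕ) (q : Bond d × ℕ) => ω (Nat.pair (enc d q.1) q.2)) :=
    measurable_pi_lambda _ fun q => measurable_pi_apply _
  have m4 : Measurable (fun (x : Bond d → ℕ → ℕ) i => thr p (x i)) :=
    measurable_pi_lambda _ fun b => (measurable_thr p).comp (measurable_pi_apply b)
  have m3 := (MeasurableEquiv.curry (Bond d) ℕ ℕ).measurable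
  rw [P, hc, ← Measure.map_map m4 (m3.comp (m2.comp m1)), ← Measure.map_map m3 (m2.comp m1),
    ← Measure.map_map m2 m1]
  change Measure.map _ (Measure.map _ (Measure.map _ (Measure.map _ unitU))) = _
  rw [digits_law, h1]
  erw [h2, h3]
  rfl

/-! ### Product-measure facts -/

/-- `A` depends only on the bonds in `S`. -/
def Dep (A : Set (Config 1)) (S : Finset (Bond 1)) : Prop :=
  ∀ ω ω' : Config 1, (∀ b ∈ S, ω b = ω' b) → ω ∈ A → ω' ∈ A

/-- `A` is an increasing event. -/
def Inc (A : Set (Config 1)) : Prop :=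
  ∀ ω ω' : Config 1, (∀ b, ω b = true → ω' b = true) → ω ∈ A → ω' ∈ A

/-- Increasing event depending on finitely many bonds. -/
def Good (A : Set (Config 1)) : Prop := (∃ S, Dep A S) ∧ Inc A

lemma Dep.mono {A : Set (Config 1)} {S T : Finset (Bond 1)} (h : Dep A S) (hST : S ⊆ T) :
    Dep A T := fun ω ω' hb => h ω ω' fun b hbS => hb b (hST hbS)

lemma Dep.inter {A B : Set (Config 1)} {S T : Finset (Bond 1)} (h : Dep A S) (h' : Dep B T) :
    Dep (A ∩ B) (S ∪ T) := fun ω ω' hb hω =>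
  ⟨(h.mono Finset.subset_union_left) ω ω' hb hω.1, (h'.mono Finset.subset_union_right) ω ω' hb hω.2⟩

lemma Good.inter {A B : Set (Config 1)} (h : Good A) (h' : Good B) : Good (A ∩ B) := by
  obtain ⟨⟨S, hS⟩, hA⟩ := h
  obtain ⟨⟨T, hT⟩, hB⟩ := h'
  exact ⟨⟨_, hS.inter hT⟩, fun ω ω' hb hω => ⟨hA ω ω' hb hω.1, hB ω ω' hb hω.2⟩⟩

lemma Good.union {A B : Set (Config 1)} (h : Good A) (h' : Good B) : Good (A ∪ B) := by
  obtain ⟨⟨S, hS⟩, hA⟩ := h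
  obtain ⟨⟨T, hT⟩, hB⟩ := h'
  refine ⟨⟨S ∪ T, fun ω ω' hb hω => ?_⟩, fun ω ω' hb hω => hω.imp (hA ω ω' hb) (hB ω ω' hb)⟩
  exact hω.imp ((hS.mono Finset.subset_union_left) ω ω' hb)
    ((hT.mono Finset.subset_union_right) ω ω' hb)

/-- Extension of a finite configuration by `false`. -/
noncomputable def extF (S : Finset (Bond 1)) (c : S → Bool) : Config 1 :=
  fun b => if h : b ∈ S then c ⟨b, h⟩ else false

lemma Dep.eq_preimage {A : Set (Config 1)} {S : Finset (Bond 1)} (h : Dep A S) :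
    A = S.restrict ⁻¹' {c | extF S c ∈ A} := by
  ext ω
  have hb : ∀ b ∈ S, ω b = extF S (S.restrict ω) b := fun b hb => by simp [extF, hb]
  simp only [Set.mem_preimage, Set.mem_ofPred_eq]
  exact ⟨h _ _ hb, h _ _ fun b hbS => (hb b hbS).symm⟩

lemma Dep.measurableSet {A : Set (Config 1)} {S : Finset (Bond 1)} (h : Dep A S) :
    MeasurableSet A := by
  rw [h.eq_preimage]
  exact (Finset.measurable_restrict S) (MeasurableSet.of_discrete)

lemma Good.measurableSet {A : Set (Config 1)} (h : Good A) : MeasurableSet A :=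
  h.1.choose_spec.measurableSet

instance P_prob (p : ℝ) : IsProbabilityMeasure (P 1 p) := by
  rw [P_eq]; infer_instance

lemma Dep.real_eq (p : ℝ) {A : Set (Config 1)} {S : Finset (Bond 1)} (h : Dep A S) :
    (P 1 p).real A = ∑ c : S → Bool,
      (∏ b, (bern p).real {c b}) * (if extF S c ∈ A then 1 else 0) := by
  conv_lhs => rw [h.eq_preimage]
  rw [P_eq, ← map_measureReal_apply (Finset.measurable_restrict S) (MeasurableSet.of_discrete),
    Measure.infinitePi_map_restrict, ← Set.Finite.coe_toFinset (Set.toFinite {c | extF S c ∈ A}),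
    ← sum_measureReal_singleton]
  rw [← Finset.sum_subset (Finset.subset_univ (Set.Finite.toFinset (Set.toFinite {c | extF S c ∈ A})))]
  · refine Finset.sum_congr rfl fun c hc => ?_
    have hc' : extF S c ∈ A := by simpa using hc
    rw [if_pos hc', mul_one, measureReal_def, Measure.pi_singleton, ENNReal.toReal_prod]
    rfl
  · intro c _ hc
    have hc' : extF S c ∉ A := by simpa using hc
    rw [if_neg hc', mul_zero]

lemma good_fkg (p : ℝ) {A B : Set (Config 1)} (hA : Good A) (hB : Good B) :
    (P 1 p).real A * (P 1 p).real B ≤ (P 1 p).real (A ∩ B) := by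
  obtain ⟨⟨S, hS⟩, iA⟩ := hA
  obtain ⟨⟨T, hT⟩, iB⟩ := hB
  have dA := hS.mono (Finset.subset_union_left (s₂ := T))
  have dB := hT.mono (Finset.subset_union_right (s₁ := S))
  have dAB := hS.inter hT
  have du : Dep Set.univ (S ∪ T) := fun _ _ _ _ => trivial
  have h1 : ∑ c : ((S ∪ T : Finset (Bond 1)) → Bool), (∏ b, (bern p).real {c b}) = 1 := by
    have := du.real_eq p
    simpa using this.symm
  have mono : ∀ X : Set (Config 1), Inc X → Monotone
      (fun c : ((S ∪ T : Finset (Bond 1)) → Bool) => if extF (S ∪ T) c ∈ X then (1:ℝ) else 0) := by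
    intro X hX c c' hcc
    have : extF (S ∪ T) c ∈ X → extF (S ∪ T) c' ∈ X := by
      apply hX
      intro b
      unfold extF
      split_ifs with h
      · intro hb
        have := hcc ⟨b, h⟩
        rw [hb] at this
        exact le_antisymm (Bool.le_true _) this
      · exact id
    by_cases h : extF (S ∪ T) c ∈ X
    · simp [h, this h]
    · simp only [h, if_false]; split_ifs <;> norm_num
  have key := fkg (μ := fun c : ((S ∪ T : Finset (Bond 1)) → Bool) => ∏ b, (bern p).real {c b})
    (f := fun c => if extF (S ∪ T) c ∈ A then (1:ℝ) else 0)
    (g := fun c => if extF (S ∪ T) c ∈ B then (1:ℝ) else 0)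
    (fun c => Finset.prod_nonneg fun _ _ => measureReal_nonneg)
    (fun c => by dsimp; split_ifs <;> norm_num) (fun c => by dsimp; split_ifs <;> norm_num)
    (mono A iA) (mono B iB) (fun a b => by
      rw [← Finset.prod_mul_distrib, ← Finset.prod_mul_distrib]
      refine le_of_eq (Finset.prod_congr rfl fun i _ => ?_)
      simp only [Pi.inf_apply, Pi.sup_apply]
      cases a i <;> cases b i <;> simp [mul_comm])
  rw [h1, one_mul] at key
  rw [dA.real_eq p, dB.real_eq p, dAB.real_eq p]
  refine key.trans (le_of_eq (Finset.sum_congr rfl fun c _ => ?_))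
  congr 1
  by_cases h : extF (S ∪ T) c ∈ A <;> by_cases h' : extF (S ∪ T) c ∈ B <;> simp [h, h']

lemma good_union (p : ℝ) {A B : Set (Config 1)} (hA : Good A) (hB : Good B) :
    (1 - (P 1 p).real A) * (1 - (P 1 p).real B) ≤ 1 - (P 1 p).real (A ∪ B) := by
  have h := good_fkg p hA hB
  have h2 := measureReal_union_add_inter (μ := P 1 p) (s := A) hB.measurableSet
  nlinarith

lemma dep_indep (p : ℝ) {A B : Set (Config 1)} {S T : Finset (Bond 1)} (hA : Dep A S)
    (hB : Dep B T) (hd : Disjoint S T) :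
    (P 1 p).real (A ∩ B) = (P 1 p).real A * (P 1 p).real B := by
  have hi : ProbabilityTheory.iIndepFun (fun (b : Bond 1) (ω : Config 1) => ω b) (P 1 p) := by
    rw [P_eq]
    exact ProbabilityTheory.iIndepFun_infinitePi (X := fun _ x => x) (fun _ => measurable_id)
  have h := hi.indepFun_finset S T hd (fun b => measurable_pi_apply b)
  have := h.measure_inter_preimage_eq_mul {c | extF S c ∈ A} {c | extF T c ∈ B}
    (MeasurableSet.of_discrete) (MeasurableSet.of_discrete)
  have eA : A = (fun (ω : Config 1) (i : S) => ω i) ⁻¹' {c | extF S c ∈ A} := hA.eq_preimage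
  have eB : B = (fun (ω : Config 1) (i : T) => ω i) ⁻¹' {c | extF T c ∈ B} := hB.eq_preimage
  rw [← eA, ← eB] at this
  rw [measureReal_def, this, ENNReal.toReal_mul]
  rfl

lemma P_inj (p : ℝ) {φ : Bond 1 → Bond 1} (hφ : Function.Injective φ) {A : Set (Config 1)}
    (hA : Good A) : (P 1 p).real {ω | (fun b => ω (φ b)) ∈ A} = (P 1 p).real A := by
  have h := Measure.map_infinitePi_infinitePi_of_inj (P := fun _ : Bond 1 => bern p) hφ
  have m : Measurable (fun (ω : Config 1) b => ω (φ b)) :=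
    measurable_pi_lambda _ fun b => measurable_pi_apply _
  have : (P 1 p).map (fun (ω : Config 1) b => ω (φ b)) = P 1 p := by
    rw [P_eq]; exact h
  conv_rhs => rw [← this]
  rw [map_measureReal_apply m hA.measurableSet]
  rfl

/-- Comparison of probabilities along a relabelling of the bonds. -/
lemma P_le_of_inj (p : ℝ) {φ : Bond 1 → Bond 1} (hφ : Function.Injective φ)
    {A B : Set (Config 1)} (hB : Good B)
    (h : ∀ ω ∈ A, (fun b => ω (φ b)) ∈ B) : (P 1 p).real A ≤ (P 1 p).real B := by
  rw [← P_inj p hφ hB]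
  exact measureReal_mono h

/-! ### Paths -/

/-- The point of `ℤ^1` with coordinate `a`. -/
abbrev pt (a : ℤ) : Fin 1 → ℤ := fun _ => a

/-- `v` is an occupied path on the time interval `[s,u]`, in the sublattice of parity `q`. -/
structure OP (ω : Config 1) (q : ℤ) (s u : ℕ) (v : ℕ → ℤ) : Prop where
  par : ∀ j, s ≤ j → j ≤ u → (v j + j) % 2 = q
  step : ∀ j, s ≤ j → j < u → (v (j + 1) = v j + 1 ∨ v (j + 1) = v j - 1) ∧
    ω ((pt (v j), j), pt (v (j + 1))) = true

lemma OP.sub {ω : Config 1} {q : ℤ} {s u s' u' : ℕ} {v : ℕ → ℤ} (h : OP ω q s u v) (hs : s ≤ s')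
    (hu : u' ≤ u) : OP ω q s' u' v :=
  ⟨fun j h1 h2 => h.par j (by omega) (by omega), fun j h1 h2 => h.step j (by omega) (by omega)⟩

lemma OP.max {ω : Config 1} {q : ℤ} {s u : ℕ} {v v' : ℕ → ℤ} (h : OP ω q s u v)
    (h' : OP ω q s u v') : OP ω q s u (fun j => max (v j) (v' j)) := by
  refine ⟨fun j h1 h2 => ?_, fun j h1 h2 => ?_⟩
  · rcases max_choice (v j) (v' j) with e | e <;> simp only [e]
    · exact h.par j h1 h2
    · exact h'.par j h1 h2
  · have p1 := h.par j h1 h2.le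
    have p2 := h'.par j h1 h2.le
    obtain ⟨s1, o1⟩ := h.step j h1 h2
    obtain ⟨s2, o2⟩ := h'.step j h1 h2
    by_cases c : v j < v' j ∨ (v j = v' j ∧ v (j + 1) ≤ v' (j + 1))
    · have e1 : Max.max (v j) (v' j) = v' j := max_eq_right (by omega)
      have e2 : Max.max (v (j + 1)) (v' (j + 1)) = v' (j + 1) := max_eq_right (by omega)
      simp only [e1, e2]; exact ⟨s2, o2⟩
    · have e1 : Max.max (v j) (v' j) = v j := max_eq_left (by omega)
      have e2 : Max.max (v (j + 1)) (v' (j + 1)) = v (j + 1) := max_eq_left (by omega)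
      simp only [e1, e2]; exact ⟨s1, o1⟩

lemma OP.min {ω : Config 1} {q : ℤ} {s u : ℕ} {v v' : ℕ → ℤ} (h : OP ω q s u v)
    (h' : OP ω q s u v') : OP ω q s u (fun j => min (v j) (v' j)) := by
  refine ⟨fun j h1 h2 => ?_, fun j h1 h2 => ?_⟩
  · rcases min_choice (v j) (v' j) with e | e <;> simp only [e]
    · exact h.par j h1 h2
    · exact h'.par j h1 h2
  · have p1 := h.par j h1 h2.le
    have p2 := h'.par j h1 h2.le
    obtain ⟨s1, o1⟩ := h.step j h1 h2
    obtain ⟨s2, o2⟩ := h'.step j h1 h2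
    by_cases c : v' j < v j ∨ (v j = v' j ∧ v' (j + 1) ≤ v (j + 1))
    · have e1 : Min.min (v j) (v' j) = v' j := min_eq_right (by omega)
      have e2 : Min.min (v (j + 1)) (v' (j + 1)) = v' (j + 1) := min_eq_right (by omega)
      simp only [e1, e2]; exact ⟨s2, o2⟩
    · have e1 : Min.min (v j) (v' j) = v j := min_eq_left (by omega)
      have e2 : Min.min (v (j + 1)) (v' (j + 1)) = v (j + 1) := min_eq_left (by omega)
      simp only [e1, e2]; exact ⟨s1, o1⟩

lemma OP.concat {ω : Config 1} {q : ℤ} {s r u : ℕ} {v v' : ℕ → ℤ} (h : OP ω q s r v)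
    (h' : OP ω q r u v') (e : v r = v' r) :
    OP ω q s u (fun j => if j ≤ r then v j else v' j) := by
  refine ⟨fun j h1 h2 => ?_, fun j h1 h2 => ?_⟩
  · by_cases c : j ≤ r <;> simp only [c, if_true, if_false]
    · exact h.par j h1 c
    · exact h'.par j (by omega) h2
  · by_cases c : j + 1 ≤ r
    · have c' : j ≤ r := by omega
      simp only [c, c', if_true]
      exact h.step j h1 c
    · by_cases c' : j ≤ r
      · have : j = r := by omega
        subst this
        simp only [c, le_refl, if_true, if_false, e]
        exact h'.step j le_rfl h2
      · simp only [c, c', if_false]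
        exact h'.step j (by omega) h2

lemma OP.bound {ω : Config 1} {q : ℤ} {s u : ℕ} {v : ℕ → ℤ} (h : OP ω q s u v) (j : ℕ)
    (h1 : s ≤ j) (h2 : j ≤ u) : |v j - v s| ≤ (j : ℤ) - s := by
  induction j, h1 using Nat.le_induction with
  | base => simp
  | succ j hj ih =>
    have := ih (by omega)
    have := (h.step j hj (by omega)).1
    push_cast
    rw [abs_le] at *
    omega

/-- The event that some path satisfying `Q` is occupied. -/
def Ev (q : ℤ) (Q : ℕ → ℕ → (ℕ → ℤ) → Prop) : Set (Config 1) :=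
  {ω | ∃ s u v, Q s u v ∧ OP ω q s u v}

/-- A finite box of bonds. -/
noncomputable def box (K : ℕ) (s u : ℕ) : Finset (Bond 1) :=
  (Finset.Icc (-(K : ℤ)) K ×ˢ Finset.Ico s u ×ˢ Finset.Icc (-(K : ℤ)) K).image
    (fun z => ((pt z.1, z.2.1), pt z.2.2))

lemma mem_box {K s u j : ℕ} {a b : ℤ} (ha : |a| ≤ K) (hb : |b| ≤ K) (h1 : s ≤ j) (h2 : j < u) :
    ((pt a, j), pt b) ∈ box K s u := by
  unfold box
  rw [Finset.mem_image]
  rw [abs_le] at ha hb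
  exact ⟨(a, j, b), by simp; omega, rfl⟩

lemma box_disjoint {K s u u' : ℕ} {s' : ℕ} (h : u ≤ s') : Disjoint (box K s u) (box K s' u') := by
  rw [Finset.disjoint_left]
  intro b hb hb'
  unfold box at hb hb'
  rw [Finset.mem_image] at hb hb'
  obtain ⟨⟨a, j, c⟩, h1, e1⟩ := hb
  obtain ⟨⟨a', j', c'⟩, h2, e2⟩ := hb'
  rw [← e2] at e1
  simp only [Prod.mk.injEq] at e1
  simp only [Finset.mem_product, Finset.mem_Ico] at h1 h2
  omega

lemma Ev_dep {q : ℤ} {Q : ℕ → ℕ → (ℕ → ℤ) → Prop} {K s0 u0 : ℕ}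
    (hQ : ∀ ω s u v, Q s u v → OP ω q s u v →
      s0 ≤ s ∧ u ≤ u0 ∧ ∀ j, s ≤ j → j ≤ u → |v j| ≤ K) : Dep (Ev q Q) (box K s0 u0) := by
  rintro ω ω' hb ⟨s, u, v, hq, hv⟩
  obtain ⟨h1, h2, h3⟩ := hQ ω s u v hq hv
  refine ⟨s, u, v, hq, hv.par, fun j ja jb => ⟨(hv.step j ja jb).1, ?_⟩⟩
  rw [← hb _ (mem_box (h3 j ja jb.le) (h3 (j + 1) (by omega) (by omega)) (by omega) (by omega))]
  exact (hv.step j ja jb).2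

lemma Ev_inc (q : ℤ) (Q : ℕ → ℕ → (ℕ → ℤ) → Prop) : Inc (Ev q Q) := by
  rintro ω ω' hb ⟨s, u, v, hq, hv⟩
  exact ⟨s, u, v, hq, hv.par, fun j ja jb => ⟨(hv.step j ja jb).1, hb _ (hv.step j ja jb).2⟩⟩

/-- Start at `a`. -/
lemma Ev_good {q : ℤ} {Q : ℕ → ℕ → (ℕ → ℤ) → Prop} (K u0 : ℕ)
    (hQ : ∀ s u v, Q s u v → u ≤ u0 ∧ ∃ j, s ≤ j ∧ j ≤ u ∧ |v j| ≤ K) : Good (Ev q Q) := by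
  refine ⟨⟨box (K + u0 + u0) 0 u0, Ev_dep fun ω s u v hq hv => ?_⟩, Ev_inc q Q⟩
  obtain ⟨h1, i, i1, i2, hi⟩ := hQ s u v hq
  refine ⟨by omega, h1, fun j j1 j2 => ?_⟩
  have b1 := hv.bound i i1 i2
  have b2 := hv.bound j j1 j2
  push_cast
  rw [abs_le] at *
  omega

/-! ### The events -/

/-- survival from the origin to time `t` -/
def evS (t : ℕ) : Set (Config 1) := Ev 0 fun s u v => s = 0 ∧ u = t ∧ v 0 = 0
/-- backward survival from `(x,t)` -/
def evB (x : ℤ) (t : ℕ) : Set (Config 1) := Ev 0 fun s u v => s = 0 ∧ u = t ∧ v t = x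
/-- connection `(0,0) → (x,t)` -/
def evT (x : ℤ) (t : ℕ) : Set (Config 1) := Ev 0 fun s u v => s = 0 ∧ u = t ∧ v 0 = 0 ∧ v t = x
/-- vertical crossing of `[m,m+w] × [a,b]`, whose final position lies in `[lo,hi]` -/
def evV (q m : ℤ) (w a b : ℕ) (lo hi : ℤ) : Set (Config 1) := Ev q fun s u v =>
  s = a ∧ u = b ∧ (∀ j, a ≤ j → j ≤ b → m ≤ v j ∧ v j ≤ m + w) ∧ lo ≤ v b ∧ v b ≤ hi
/-- path from column `A` to column `B` before time `t` -/
def evH (q A B : ℤ) (t : ℕ) : Set (Config 1) := Ev q fun s u v =>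
  s ≤ u ∧ u ≤ t ∧ v s = A ∧ v u = B

lemma evS_good (t : ℕ) : Good (evS t) := Ev_good 0 t (by
  rintro s u v ⟨rfl, rfl, h⟩; exact ⟨le_rfl, 0, le_rfl, by omega, by simp [h]⟩)
lemma evT_good (x : ℤ) (t : ℕ) : Good (evT x t) := Ev_good 0 t (by
  rintro s u v ⟨rfl, rfl, h, _⟩; exact ⟨le_rfl, 0, le_rfl, by omega, by simp [h]⟩)
lemma evB_good (x : ℤ) (t : ℕ) : Good (evB x t) := Ev_good x.natAbs t (by
  rintro s u v ⟨rfl, rfl, h⟩; exact ⟨le_rfl, u, by omega, by omega, by simp [h]⟩)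
lemma evH_good (q A B : ℤ) (t : ℕ) : Good (evH q A B t) := Ev_good A.natAbs t (by
  rintro s u v ⟨h1, h2, h, _⟩; exact ⟨h2, s, by omega, by omega, by simp [h]⟩)

lemma evV_dep (q m : ℤ) (w a b : ℕ) (lo hi : ℤ) :
    Dep (evV q m w a b lo hi) (box (m.natAbs + w) a b) := Ev_dep (by
  rintro ω s u v ⟨rfl, rfl, h, _⟩ _
  refine ⟨le_rfl, le_rfl, fun j h1 h2 => ?_⟩
  have := h j h1 h2
  rw [abs_le]
  omega)
lemma evV_good (q m : ℤ) (w a b : ℕ) (lo hi : ℤ) : Good (evV q m w a b lo hi) :=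
  ⟨⟨_, evV_dep q m w a b lo hi⟩, Ev_inc _ _⟩

/-- The deterministic connection lemma. -/
lemma connect {ω : Config 1} {t w : ℕ} {x m c l A B : ℤ} {lo hi lo' hi' : ℤ}
    (hS : ω ∈ evS t) (hB : ω ∈ evB x t) (hL : ω ∈ evV 0 l w 0 t lo' hi')
    (hM : ω ∈ evV 0 m w 0 t lo x) (hR : ω ∈ evV 0 c w 0 t x hi) (hH : ω ∈ evH 0 A B t)
    (hm : -1 ≤ m) (hc : 0 ≤ c) (hcB : c + w - 1 ≤ B) (hl : l + w ≤ 1) (hA : A ≤ l + 1) :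
    ω ∈ evT x t := by
  obtain ⟨_, _, γ, ⟨rfl, rfl, g0⟩, hγ⟩ := hS
  obtain ⟨_, _, η, ⟨rfl, rfl, e1⟩, hη⟩ := hB
  obtain ⟨_, _, L, ⟨rfl, rfl, L1, -, -⟩, hL⟩ := hL
  obtain ⟨_, _, M, ⟨rfl, rfl, M1, -, M2⟩, hM⟩ := hM
  obtain ⟨_, t, R, ⟨rfl, rfl, R1, R2, -⟩, hR⟩ := hR
  obtain ⟨s, u, h, ⟨su, ut, h1, h2⟩, hh⟩ := hH
  -- push the survival path to the right of `L`
  have G1 := hγ.max hL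
  set γ1 : ℕ → ℤ := fun j => Max.max (γ j) (L j) with hγ1
  have pL0 := hL.par 0 le_rfl (by omega)
  have bL0 := L1 0 le_rfl (by omega)
  have γ10 : γ1 0 = 0 := by simp only [hγ1, g0]; omega
  have γ1s : h s ≤ γ1 s := by
    have p1 := G1.par s (by omega) (by omega)
    have p2 := hh.par s (by omega) (by omega)
    have p3 := L1 s (by omega) (by omega)
    have : L s ≤ γ1 s := le_max_right _ _
    omega
  -- follow the horizontal crossing
  have K1 := (G1.sub (le_refl 0) (by omega : s ≤ t)).concat
    ((G1.sub (by omega : 0 ≤ s) ut).max hh) (by omega)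
  set k : ℕ → ℤ := fun j => if j ≤ s then γ1 j else Max.max (γ1 j) (h j) with hk
  have k0 : k 0 = 0 := by simp [hk, γ10]
  have ku : R u ≤ k u := by
    have hku : h u ≤ k u := by
      simp only [hk]
      split_ifs with c
      · have : s = u := by omega
        subst this; exact γ1s
      · exact le_max_right _ _
    have p1 := K1.par u (by omega) (by omega)
    have p2 := hR.par u (by omega) (by omega)
    have p3 := hh.par u (by omega) (by omega)
    have p4 := R1 u (by omega) (by omega)
    omega
  have K2 := (K1.min (hR.sub (le_refl 0) ut)).concat (hR.sub (by omega : 0 ≤ u) (le_refl t))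
    (by omega)
  set k2 : ℕ → ℤ := fun j => if j ≤ u then Min.min (k j) (R j) else R j with hk2
  have bR0 := R1 0 le_rfl (by omega)
  have k20 : k2 0 = 0 := by simp only [hk2, k0]; simp; omega
  have k2t : x ≤ k2 t := by
    simp only [hk2]
    split_ifs with c
    · have : u = t := by omega
      subst this
      omega
    · exact R2
  -- path ending to the left of `x`
  have K3 := hγ.min hM
  set k3 : ℕ → ℤ := fun j => Min.min (γ j) (M j) with hk3
  have pM0 := hM.par 0 le_rfl (by omega)
  have bM0 := M1 0 le_rfl (by omega)
  have k30 : k3 0 = 0 := by simp only [hk3, g0]; omega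
  have k3t : k3 t ≤ x := (min_le_right _ _).trans M2
  by_cases c : 0 ≤ η 0
  · exact ⟨0, t, _, ⟨rfl, rfl, by omega, by omega⟩, K2.min hη⟩
  · exact ⟨0, t, _, ⟨rfl, rfl, by omega, by omega⟩, K3.max hη⟩

/-! ### Symmetries and links with the original events -/

/-- translation of bonds -/
def shB (k : ℤ) (i : ℕ) (b : Bond 1) : Bond 1 :=
  ((pt (b.1.1 0 + k), b.1.2 + i), pt (b.2 0 + k))
/-- reflection of bonds -/
def rfB (k : ℤ) (b : Bond 1) : Bond 1 := ((pt (k - b.1.1 0), b.1.2), pt (k - b.2 0))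
/-- time reversal of bonds -/
def trB (x : ℤ) (t : ℕ) (b : Bond 1) : Bond 1 :=
  if b.1.2 < t then ((pt (x - b.2 0), t - 1 - b.1.2), pt (x - b.1.1 0)) else b

lemma bond_ext {b b' : Bond 1} (h1 : b.1.1 0 = b'.1.1 0) (h2 : b.1.2 = b'.1.2)
    (h3 : b.2 0 = b'.2 0) : b = b' := by
  refine Prod.ext (Prod.ext (funext fun i => ?_) h2) (funext fun i => ?_)
  · rw [Subsingleton.elim i 0]; exact h1
  · rw [Subsingleton.elim i 0]; exact h3

lemma bond_proj {b b' : Bond 1} (h : b = b') :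
    b.1.1 0 = b'.1.1 0 ∧ b.1.2 = b'.1.2 ∧ b.2 0 = b'.2 0 := by subst h; simp

lemma shB_inj (k : ℤ) (i : ℕ) : Function.Injective (shB k i) := by
  intro b b' h
  obtain ⟨h1, h2, h3⟩ := bond_proj h
  simp only [shB, pt] at h1 h2 h3
  exact bond_ext (by omega) (by omega) (by omega)

lemma rfB_inj (k : ℤ) : Function.Injective (rfB k) := by
  intro b b' h
  obtain ⟨h1, h2, h3⟩ := bond_proj h
  simp only [rfB, pt] at h1 h2 h3
  exact bond_ext (by omega) (by omega) (by omega)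

lemma trB_inj (x : ℤ) (t : ℕ) : Function.Injective (trB x t) := by
  intro b b' h
  obtain ⟨h1, h2, h3⟩ := bond_proj h
  unfold trB at h1 h2 h3
  by_cases c : b.1.2 < t <;> by_cases c' : b'.1.2 < t <;>
    simp only [c, c', if_true, if_false, pt] at h1 h2 h3 <;>
    exact bond_ext (by omega) (by omega) (by omega)

lemma OP.shift {ω : Config 1} {q : ℤ} {s u : ℕ} {v : ℕ → ℤ} (k : ℤ) (i : ℕ)
    (h : OP ω q (s + i) (u + i) v) (q' : ℤ) (hq : (q - k - i) % 2 = q') :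
    OP (fun b => ω (shB k i b)) q' s u (fun j => v (j + i) - k) := by
  refine ⟨fun j h1 h2 => ?_, fun j h1 h2 => ?_⟩
  · have := h.par (j + i) (by omega) (by omega)
    push_cast at this
    omega
  · have := h.step (j + i) (by omega) (by omega)
    have e : j + 1 + i = j + i + 1 := by omega
    refine ⟨by rw [e]; omega, ?_⟩
    have e2 : shB k i ((pt (v (j + i) - k), j), pt (v (j + 1 + i) - k)) =
        ((pt (v (j + i)), j + i), pt (v (j + i + 1))) :=
      bond_ext (by simp [shB]) (by simp [shB]) (by simp [shB, e])
    rw [e2]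
    exact this.2

lemma OP.refl {ω : Config 1} {q : ℤ} {s u : ℕ} {v : ℕ → ℤ} (k : ℤ)
    (h : OP ω q s u v) (q' : ℤ) (hq : (q + k) % 2 = q') :
    OP (fun b => ω (rfB k b)) q' s u (fun j => k - v j) := by
  refine ⟨fun j h1 h2 => ?_, fun j h1 h2 => ?_⟩
  · have := h.par j (by omega) (by omega)
    omega
  · have := h.step j (by omega) (by omega)
    refine ⟨by omega, ?_⟩
    have e2 : rfB k ((pt (k - v j), j), pt (k - v (j + 1))) =
        ((pt (v j), j), pt (v (j + 1))) :=
      bond_ext (by simp [rfB]) (by simp [rfB]) (by simp [rfB])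
    rw [e2]
    exact this.2

lemma OP.rev {ω : Config 1} {t : ℕ} {v : ℕ → ℤ} (x : ℤ)
    (h : OP ω 0 0 t v) (hx : (x - t) % 2 = 0) :
    OP (fun b => ω (trB x t b)) 0 0 t (fun j => x - v (t - j)) := by
  refine ⟨fun j h1 h2 => ?_, fun j h1 h2 => ?_⟩
  · have := h.par (t - j) (by omega) (by omega)
    push_cast [h2] at this
    omega
  · have := h.step (t - j - 1) (by omega) (by omega)
    have e : t - j - 1 + 1 = t - j := by omega
    have e' : t - (j + 1) = t - j - 1 := by omega
    rw [e] at this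
    refine ⟨by rw [e']; omega, ?_⟩
    have e2 : trB x t ((pt (x - v (t - j)), j), pt (x - v (t - (j + 1)))) =
        ((pt (v (t - j - 1)), t - j - 1), pt (v (t - j))) := by
      apply bond_ext
      · simp [trB, h2, e']
      · simp [trB, h2]; omega
      · simp [trB, h2]
    rw [e2]
    exact this.2

lemma evV_shift (p : ℝ) (q m : ℤ) (w a b : ℕ) (lo hi : ℤ) (i : ℕ) (k q' : ℤ)
    (hq : (q - k - i) % 2 = q') :
    (P 1 p).real (evV q m w (a + i) (b + i) lo hi) ≤
      (P 1 p).real (evV q' (m - k) w a b (lo - k) (hi - k)) := by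
  refine P_le_of_inj p (shB_inj k i) (evV_good ..) ?_
  rintro ω ⟨_, _, v, ⟨rfl, rfl, h1, h2, h3⟩, h⟩
  refine ⟨_, _, _, ⟨rfl, rfl, fun j ja jb => ?_, ?_, ?_⟩, h.shift k i q' hq⟩
  · have := h1 (j + i) (by omega) (by omega)
    omega
  · omega
  · omega

lemma evH_shift (p : ℝ) (q A B : ℤ) (t : ℕ) (k q' : ℤ) (hq : (q - k) % 2 = q') :
    (P 1 p).real (evH q A B t) ≤ (P 1 p).real (evH q' (A - k) (B - k) t) := by
  refine P_le_of_inj p (shB_inj k 0) (evH_good ..) ?_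
  rintro ω ⟨s, u, v, ⟨h0, h1, h2, h3⟩, h⟩
  exact ⟨_, _, _, ⟨h0, h1, by simp [h2], by simp [h3]⟩,
    OP.shift (s := s) (u := u) k 0 h q' (by simpa using hq)⟩

lemma evH_refl (p : ℝ) (q A B : ℤ) (t : ℕ) (k q' : ℤ) (hq : (q + k) % 2 = q') :
    (P 1 p).real (evH q A B t) ≤ (P 1 p).real (evH q' (k - A) (k - B) t) := by
  refine P_le_of_inj p (rfB_inj k) (evH_good ..) ?_
  rintro ω ⟨s, u, v, ⟨h0, h1, h2, h3⟩, h⟩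
  exact ⟨_, _, _, ⟨h0, h1, by simp [h2], by simp [h3]⟩, h.refl k q' hq⟩

lemma evT_refl (p : ℝ) (x : ℤ) (t : ℕ) :
    (P 1 p).real (evT x t) ≤ (P 1 p).real (evT (-x) t) := by
  refine P_le_of_inj p (rfB_inj 0) (evT_good ..) ?_
  rintro ω ⟨s, u, v, ⟨h0, h1, h2, h3⟩, h⟩
  exact ⟨_, _, _, ⟨h0, h1, by simp [h2], by simp [h3]⟩, h.refl 0 0 (by simp)⟩

lemma evS_rev (p : ℝ) (x : ℤ) (t : ℕ) (hx : (x - t) % 2 = 0) :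
    (P 1 p).real (evS t) ≤ (P 1 p).real (evB x t) := by
  refine P_le_of_inj p (trB_inj x t) (evB_good ..) ?_
  rintro ω ⟨_, _, v, ⟨rfl, rfl, h2⟩, h⟩
  exact ⟨_, _, _, ⟨rfl, rfl, by simp [h2]⟩, h.rev x hx⟩

lemma norm1_one (x : Fin 1 → ℤ) : norm1 x = |x 0| := by simp [norm1]

lemma pt_eta (x : Fin 1 → ℤ) : pt (x 0) = x := by
  funext i; rw [Subsingleton.elim i 0]

lemma ConnectedIn.toOP {ω : Config 1} {R : Set ((Fin 1 → ℤ) × ℕ)} {x y : Fin 1 → ℤ} {s u : ℕ}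
    (h : ConnectedIn ω R x s y u) : s ≤ u ∧ ∃ v : ℕ → ℤ, v s = x 0 ∧ v u = y 0 ∧
      (∀ j, s ≤ j → j ≤ u → (pt (v j), j) ∈ R) ∧ OP ω ((x 0 + s) % 2) s u v := by
  rcases h with ⟨rfl, rfl, h⟩ | ⟨h, v, h1, h2, h3, h4⟩
  · refine ⟨le_rfl, fun _ => x 0, rfl, rfl, fun j a b => ?_, fun j a b => ?_, fun j a b => ?_⟩
    · obtain rfl : j = s := by omega
      rw [pt_eta]; exact h
    · obtain rfl : j = s := by omega
      rfl
    · omega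
  · have st : ∀ j, s ≤ j → j < u → (v (j + 1) 0 = v j 0 + 1 ∨ v (j + 1) 0 = v j 0 - 1) := by
      intro j a b
      have := (h4 j a b).1
      rw [norm1_one, Pi.sub_apply] at this
      rcases abs_cases (v (j + 1) 0 - v j 0) with h | h <;> omega
    refine ⟨h.le, fun j => v j 0, by simp [h1], by simp [h2], fun j a b => ?_, fun j a b => ?_,
      fun j a b => ⟨st j a b, ?_⟩⟩
    · rw [pt_eta]; exact h3 j a b
    · induction j, a using Nat.le_induction with
      | base => rw [h1]
      | succ j hj ih =>
        have := ih (by omega)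
        have := st j hj (by omega)
        push_cast
        omega
    · simp only [pt_eta]; exact (h4 j a b).2

lemma OP.toConnected {ω : Config 1} {q : ℤ} {u : ℕ} {v : ℕ → ℤ} (hu : 0 < u)
    (h : OP ω q 0 u v) : Connected ω (pt (v 0)) 0 (pt (v u)) u := by
  refine Or.inr ⟨hu, fun j => pt (v j), rfl, rfl, fun _ _ _ => trivial, fun j a b => ?_⟩
  obtain ⟨h1, h2⟩ := h.step j a b
  refine ⟨?_, h2⟩
  rw [norm1_one, Pi.sub_apply]
  simp only
  rcases h1 with e | e <;> simp [e]

lemma theta_le (p : ℝ) (t : ℕ) : theta 1 p t ≤ (P 1 p).real (evS t) := by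
  refine measureReal_mono ?_
  rintro ω ⟨y, h⟩
  obtain ⟨-, v, h1, h2, -, h4⟩ := h.toOP
  exact ⟨0, t, v, ⟨rfl, rfl, h1⟩, by simpa using h4⟩

lemma le_tau (p : ℝ) (x : ℤ) (t : ℕ) (ht : 1 ≤ t) :
    (P 1 p).real (evT x t) ≤ tau 1 p (pt x) t := by
  refine measureReal_mono ?_
  rintro ω ⟨_, _, v, ⟨rfl, rfl, h1, h2⟩, h⟩
  have := h.toConnected (by omega)
  rw [h1, h2] at this
  exact this

lemma tau_zero (p : ℝ) (x : ℤ) (t : ℕ) (hx : (t : ℤ) < |x|) : tau 1 p (pt x) t = 0 := by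
  unfold tau
  have : {ω : Config 1 | Connected ω 0 0 (pt x) t} = ∅ := by
    rw [Set.eq_empty_iff_forall_notMem]
    intro ω h
    obtain ⟨-, v, h1, h2, -, h4⟩ := ConnectedIn.toOP (h : Connected ω 0 0 (pt x) t)
    have := h4.bound t (by omega) le_rfl
    simp only [h1, h2, Pi.zero_apply, pt] at this
    simp at this
    omega
  rw [this]; simp

lemma tau_nonneg (p : ℝ) (x : Fin 1 → ℤ) (t : ℕ) : 0 ≤ tau 1 p x t := ENNReal.toReal_nonneg

/-- Lower bound for `chi` by a finite sum. -/
lemma le_chi (p : ℝ) (t : ℕ) (ht : 1 ≤ t) (F : Finset ℤ) :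
    ∑ x ∈ F, (P 1 p).real (evT x t) ≤ chi 1 p t := by
  have hinj : Function.Injective pt := fun a b h => congrFun h 0
  have hs : Summable fun x : Fin 1 → ℤ => tau 1 p x t := by
    refine summable_of_ne_finset_zero (s := (Finset.Icc (-(t : ℤ)) t).image pt) fun x hx => ?_
    rw [← pt_eta x]
    apply tau_zero
    by_contra hc
    apply hx
    rw [Finset.mem_image]
    refine ⟨x 0, ?_, pt_eta x⟩
    rw [not_lt, abs_le] at hc
    simpa using hc
  calc ∑ x ∈ F, (P 1 p).real (evT x t) ≤ ∑ x ∈ F, tau 1 p (pt x) t :=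
        Finset.sum_le_sum fun x _ => le_tau p x t ht
    _ = ∑ x ∈ F.image pt, tau 1 p x t := by
        rw [Finset.sum_image (fun a _ b _ h => hinj h)]
    _ ≤ chi 1 p t := hs.sum_le_tsum _ (fun x _ => tau_nonneg p x t)

/-! ### Estimates -/

lemma real_bounds (p : ℝ) (A : Set (Config 1)) : 0 ≤ (P 1 p).real A ∧ (P 1 p).real A ≤ 1 :=
  ⟨measureReal_nonneg, measureReal_le_one⟩

lemma union_two (p β : ℝ) {A B : Set (Config 1)} (hA : Good A) (hB : Good B)
    (hβ : β ≤ 1) (h1 : (P 1 p).real A ≤ β) (h2 : (P 1 p).real B ≤ β) :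
    (1 - β) ^ 2 ≤ 1 - (P 1 p).real (A ∪ B) := by
  refine le_trans ?_ (good_union p hA hB)
  nlinarith [mul_le_mul (sub_le_sub_left h1 1) (sub_le_sub_left h2 1) (by linarith) (by linarith)]

lemma exists_max (b : ℤ → ℝ) (x y : ℤ) : ∃ A, (A = x ∨ A = y) ∧ b x ≤ b A ∧ b y ≤ b A := by
  rcases le_total (b x) (b y) with h | h
  · exact ⟨y, Or.inr rfl, h, le_rfl⟩
  · exact ⟨x, Or.inl rfl, le_rfl, h⟩

lemma horiz (p : ℝ) (w t : ℕ) : ∃ A : ℤ, (A = -w ∨ A = -w + 1) ∧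
    (1 - (P 1 p).real (evH 0 A (A + 3 * w) t)) ^ 4 ≤ 1 - H p (3 * w) t := by
  obtain ⟨A, hA, m1, m2⟩ := exists_max (fun A => (P 1 p).real (evH 0 A (A + 3 * w) t))
    (-w) (-w + 1)
  refine ⟨A, hA, ?_⟩
  set β := (P 1 p).real (evH 0 A (A + 3 * w) t) with hβ
  have hm : ∀ A' : ℤ, (A' = -w ∨ A' = -w + 1) →
      (P 1 p).real (evH 0 A' (A' + 3 * w) t) ≤ β := by
    rintro A' (rfl | rfl)
    · exact m1
    · exact m2
  have β1 : β ≤ 1 := (real_bounds p _).2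
  have sel : ∀ q : ℤ, ∃ A' : ℤ, (A' = -w ∨ A' = -w + 1) ∧ (q + A') % 2 = 0 := by
    intro q
    by_cases c : (q + -w) % 2 = 0
    · exact ⟨_, Or.inl rfl, c⟩
    · exact ⟨_, Or.inr rfl, by omega⟩
  have r : ∀ q : ℤ, (P 1 p).real (evH q 0 (3 * w) t) ≤ β := by
    intro q
    obtain ⟨A', h1, h2⟩ := sel q
    refine le_trans ?_ (hm A' h1)
    have := evH_shift p q 0 (3 * w) t (-A') 0 (by omega)
    rwa [show (0 : ℤ) - -A' = A' by ring, show (3 * w : ℤ) - -A' = A' + 3 * w by ring] at this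
  have l : ∀ q : ℤ, (P 1 p).real (evH q (3 * w) 0 t) ≤ β := by
    intro q
    obtain ⟨A', h1, h2⟩ := sel (q + 3 * w)
    refine le_trans ?_ (hm A' h1)
    have := evH_refl p q (3 * w) 0 t (A' + 3 * w) 0 (by omega)
    rwa [show (A' + 3 * w : ℤ) - 3 * w = A' by ring,
      show (A' + 3 * w : ℤ) - 0 = A' + 3 * w by ring] at this
  have g1 := (evH_good 0 0 (3 * w) t).union (evH_good 1 0 (3 * w) t)
  have g2 := (evH_good 0 (3 * w) 0 t).union (evH_good 1 (3 * w) 0 t)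
  have u1 := union_two p β (evH_good 0 0 (3 * w) t) (evH_good 1 0 (3 * w) t) β1 (r 0) (r 1)
  have u2 := union_two p β (evH_good 0 (3 * w) 0 t) (evH_good 1 (3 * w) 0 t) β1 (l 0) (l 1)
  have u3 := union_two p (1 - (1 - β) ^ 2) g1 g2 (by nlinarith) (by linarith) (by linarith)
  have hH : H p (3 * w) t ≤ (P 1 p).real ((evH 0 0 (3 * w) t ∪ evH 1 0 (3 * w) t) ∪
      (evH 0 (3 * w) 0 t ∪ evH 1 (3 * w) 0 t)) := by
    refine measureReal_mono ?_
    rintro ω ⟨x, y, s, u, hx, hy, h | h⟩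
    · obtain ⟨su, v, h1, h2, h3, h4⟩ := h.toOP
      have h5 : u ≤ t := (h3 u su le_rfl).2.2
      left
      push_cast at hy
      rcases Int.emod_two_eq_zero_or_one (x 0 + s) with e | e <;> rw [e] at h4
      · exact Or.inl ⟨s, u, v, ⟨su, h5, by omega, by omega⟩, h4⟩
      · exact Or.inr ⟨s, u, v, ⟨su, h5, by omega, by omega⟩, h4⟩
    · obtain ⟨su, v, h1, h2, h3, h4⟩ := h.toOP
      have h5 : s ≤ t := (h3 s su le_rfl).2.2
      right
      push_cast at hy
      rcases Int.emod_two_eq_zero_or_one (y 0 + u) with e | e <;> rw [e] at h4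
      · exact Or.inl ⟨u, s, v, ⟨su, h5, by omega, by omega⟩, h4⟩
      · exact Or.inr ⟨u, s, v, ⟨su, h5, by omega, by omega⟩, h4⟩
  calc (1 - β) ^ 4 = (1 - (1 - (1 - β) ^ 2)) ^ 2 := by ring
    _ ≤ _ := u3
    _ ≤ _ := by linarith

lemma vert (p : ℝ) (w t : ℕ) : ∃ m : ℤ, (m = 0 ∨ m = -1) ∧
    (1 - (P 1 p).real (evV 0 m w 0 t m (m + w)) ^ 3) ^ 2 ≤ 1 - V p w (3 * t) := by
  obtain ⟨m, hm, m1, m2⟩ := exists_max (fun m => (P 1 p).real (evV 0 m w 0 t m (m + w))) 0 (-1)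
  refine ⟨m, hm, ?_⟩
  set v := (P 1 p).real (evV 0 m w 0 t m (m + w)) with hv
  have hm : ∀ A' : ℤ, (A' = 0 ∨ A' = -1) →
      (P 1 p).real (evV 0 A' w 0 t A' (A' + w)) ≤ v := by
    rintro A' (rfl | rfl)
    · exact m1
    · exact m2
  have v0 : 0 ≤ v := (real_bounds p _).1
  have v1 : v ≤ 1 := (real_bounds p _).2
  have r : ∀ (q : ℤ) (i : ℕ), (P 1 p).real (evV q 0 w (0 + i) (t + i) 0 w) ≤ v := by
    intro q i
    have : ∃ A' : ℤ, (A' = 0 ∨ A' = -1) ∧ (q + A' - i) % 2 = 0 := by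
      by_cases c : (q + 0 - i) % 2 = 0
      · exact ⟨_, Or.inl rfl, c⟩
      · exact ⟨_, Or.inr rfl, by omega⟩
    obtain ⟨A', h1, h2⟩ := this
    refine le_trans ?_ (hm A' h1)
    have := evV_shift p q 0 w 0 t 0 w i (-A') 0 (by omega)
    rwa [show (0 : ℤ) - -A' = A' by ring, show (w : ℤ) - -A' = A' + w by ring] at this
  have r3 : ∀ q : ℤ, (P 1 p).real (evV q 0 w 0 (3 * t) 0 w) ≤ v ^ 3 := by
    intro q
    have hs : evV q 0 w 0 (3 * t) 0 w ⊆ evV q 0 w (0 + 0) (t + 0) 0 w ∩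
        (evV q 0 w (0 + t) (t + t) 0 w ∩ evV q 0 w (0 + 2 * t) (t + 2 * t) 0 w) := by
      rintro ω ⟨_, _, v, ⟨rfl, rfl, h1, h2, h3⟩, h⟩
      have sub : ∀ a b : ℕ, a ≤ b → b ≤ 3 * t → ω ∈ evV q 0 w a b 0 w := by
        intro a b ab hb
        refine ⟨a, b, v, ⟨rfl, rfl, fun j ja jb => h1 j (by omega) (by omega), ?_, ?_⟩,
          h.sub (by omega) hb⟩
        · exact (h1 b (by omega) hb).1
        · simpa using (h1 b (by omega) hb).2
      exact ⟨sub _ _ (by omega) (by omega), sub _ _ (by omega) (by omega),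
        sub _ _ (by omega) (by omega)⟩
    refine (measureReal_mono hs).trans ?_
    have d1 := evV_dep q 0 w (0 + 0) (t + 0) 0 w
    have d2 := evV_dep q 0 w (0 + t) (t + t) 0 w
    have d3 := evV_dep q 0 w (0 + 2 * t) (t + 2 * t) 0 w
    rw [dep_indep p d1 (d2.inter d3), dep_indep p d2 d3]
    · calc _ ≤ v * (v * v) := by
            have n := fun A => (real_bounds p A).1
            exact mul_le_mul (r q 0) (mul_le_mul (r q t) (r q (2 * t)) (n _) v0)
              (mul_nonneg (n _) (n _)) v0
        _ = v ^ 3 := by ring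
    · exact box_disjoint (by omega)
    · rw [Finset.disjoint_union_right]
      exact ⟨box_disjoint (by omega), box_disjoint (by omega)⟩
  have u := union_two p (v ^ 3) (evV_good 0 0 w 0 (3 * t) 0 w) (evV_good 1 0 w 0 (3 * t) 0 w)
    (pow_le_one₀ v0 v1) (r3 0) (r3 1)
  have hV : V p w (3 * t) ≤
      (P 1 p).real (evV 0 0 w 0 (3 * t) 0 w ∪ evV 1 0 w 0 (3 * t) 0 w) := by
    refine measureReal_mono ?_
    rintro ω ⟨x, y, h⟩
    obtain ⟨su, v, h1, h2, h3, h4⟩ := h.toOP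
    have h5 : ∀ j, 0 ≤ j → j ≤ 3 * t → 0 ≤ v j ∧ v j ≤ 0 + w := by
      intro j a b
      obtain ⟨h6, h7, -⟩ := h3 j a b
      simp only [pt] at h6 h7
      omega
    have h8 := h5 (3 * t) (by omega) le_rfl
    rcases Int.emod_two_eq_zero_or_one (x 0 + (0 : ℕ)) with e | e <;> rw [e] at h4
    · exact Or.inl ⟨_, _, v, ⟨rfl, rfl, h5, h8.1, by omega⟩, h4⟩
    · exact Or.inr ⟨_, _, v, ⟨rfl, rfl, h5, h8.1, by omega⟩, h4⟩
  linarith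

lemma numerics (ε β y : ℝ) (h0 : 0 < ε) (h1 : ε < 1) (hβ : (1 - β) ^ 4 ≤ 1 - ε)
    (hy : (1 - y) ^ 2 ≤ 1 - ε) : ε ^ 6 ≤ 2 * (β * y) := by
  set u := Real.sqrt (Real.sqrt (1 - ε)) with hu
  have u0 : 0 ≤ u := Real.sqrt_nonneg _
  have u2 : u ^ 2 = Real.sqrt (1 - ε) := Real.sq_sqrt (Real.sqrt_nonneg _)
  have u4 : u ^ 4 = 1 - ε := by
    rw [show u ^ 4 = (u ^ 2) ^ 2 by ring, u2]
    exact Real.sq_sqrt (by linarith)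
  have b : 1 - β ≤ u := by
    rw [← u4] at hβ
    exact le_of_pow_le_pow_left₀ (by norm_num) u0 hβ
  have c : 1 - y ≤ u ^ 2 := by
    rw [← u4, show u ^ 4 = (u ^ 2) ^ 2 by ring] at hy
    exact le_of_pow_le_pow_left₀ (by norm_num) (by positivity) hy
  have ul : u ≤ 1 := by
    by_contra hc
    have : 1 < u ^ 4 := one_lt_pow₀ (by linarith) (by norm_num)
    linarith
  have e : ε = 1 - u ^ 4 := by linarith
  have by' : (1 - u) * (1 - u ^ 2) ≤ β * y :=
    mul_le_mul (by linarith) (by linarith) (by nlinarith) (by linarith)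
  have q1 : (1 - u ^ 4) ^ 4 * (1 + 4 * u ^ 4) ≤ 1 := by
    have a0 : 0 ≤ u ^ 4 := by positivity
    have a1 : u ^ 4 ≤ 1 := pow_le_one₀ u0 ul
    generalize u ^ 4 = a at a0 a1
    have s1 : 1 + 4 * a ≤ (1 + a) ^ 4 := by nlinarith [pow_nonneg a0 2, pow_nonneg a0 3, pow_nonneg a0 4]
    calc (1 - a) ^ 4 * (1 + 4 * a) ≤ (1 - a) ^ 4 * (1 + a) ^ 4 :=
          mul_le_mul_of_nonneg_left s1 (by positivity)
      _ = (1 - a ^ 2) ^ 4 := by ring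
      _ ≤ 1 := pow_le_one₀ (by nlinarith) (by nlinarith)
  have q2 : (1 + u) * (1 + u ^ 2) ^ 2 ≤ 2 * (1 + 4 * u ^ 4) := by
    have a : u ^ 5 ≤ u ^ 4 := pow_le_pow_of_le_one u0 ul (by norm_num)
    nlinarith [sq_nonneg (u ^ 2 - u / 6 - 28 / 100), sq_nonneg (u - 65 / 100)]
  have q3 : (1 - u ^ 4) ^ 4 * ((1 + u) * (1 + u ^ 2) ^ 2) ≤ 2 := by
    have : 0 ≤ (1 - u ^ 4) ^ 4 := by positivity
    nlinarith [mul_le_mul_of_nonneg_left q2 this]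
  have n : 0 ≤ (1 - u) * (1 - u ^ 2) := mul_nonneg (by linarith) (by nlinarith)
  calc ε ^ 6 = (1 - u) * (1 - u ^ 2) * ((1 - u ^ 4) ^ 4 * ((1 + u) * (1 + u ^ 2) ^ 2)) := by
        rw [e]; ring
    _ ≤ (1 - u) * (1 - u ^ 2) * 2 := mul_le_mul_of_nonneg_left q3 n
    _ ≤ 2 * (β * y) := by linarith

lemma six (p : ℝ) {t w : ℕ} {x m c l A B : ℤ} {lo hi lo' hi' : ℤ} (hx : (x - t) % 2 = 0)
    (hm : -1 ≤ m) (hc : 0 ≤ c) (hcB : c + w - 1 ≤ B) (hl : l + w ≤ 1) (hA : A ≤ l + 1)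
    {θ vL vM vR β : ℝ} (θ0 : 0 ≤ θ) (L0 : 0 ≤ vL) (M0 : 0 ≤ vM) (R0 : 0 ≤ vR) (β0 : 0 ≤ β)
    (hθ : θ ≤ (P 1 p).real (evS t)) (hL : vL ≤ (P 1 p).real (evV 0 l w 0 t lo' hi'))
    (hM : vM ≤ (P 1 p).real (evV 0 m w 0 t lo x)) (hR : vR ≤ (P 1 p).real (evV 0 c w 0 t x hi))
    (hβ : β ≤ (P 1 p).real (evH 0 A B t)) :
    θ ^ 2 * β * (vL * vM * vR) ≤ (P 1 p).real (evT x t) := by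
  have step : ∀ {a b : ℝ} {X Y : Set (Config 1)}, Good X → Good Y → 0 ≤ a → 0 ≤ b →
      a ≤ (P 1 p).real X → b ≤ (P 1 p).real Y → a * b ≤ (P 1 p).real (X ∩ Y) :=
    fun gX gY a0 b0 ha hb => (mul_le_mul ha hb b0 (real_bounds p _).1).trans (good_fkg p gX gY)
  have gS := evS_good t
  have gB := evB_good x t
  have gL := evV_good 0 l w 0 t lo' hi'
  have gM := evV_good 0 m w 0 t lo x
  have gR := evV_good 0 c w 0 t x hi
  have gH := evH_good 0 A B t
  have s1 := step gS gB θ0 θ0 hθ (hθ.trans (evS_rev p x t hx))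
  have s2 := step (gS.inter gB) gL (by positivity) L0 s1 hL
  have s3 := step ((gS.inter gB).inter gL) gM (by positivity) M0 s2 hM
  have s4 := step (((gS.inter gB).inter gL).inter gM) gR (by positivity) R0 s3 hR
  have s5 := step ((((gS.inter gB).inter gL).inter gM).inter gR) gH (by positivity) β0 s4 hβ
  calc θ ^ 2 * β * (vL * vM * vR) = θ * θ * vL * vM * vR * β := by ring
    _ ≤ _ := s5
    _ ≤ _ := measureReal_mono (by
      rintro ω ⟨⟨⟨⟨⟨h1, h2⟩, h3⟩, h4⟩, h5⟩, h6⟩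
      exact connect h1 h2 h3 h4 h5 h6 hm hc hcB hl hA)

lemma evV_mono (p : ℝ) (m : ℤ) (w t : ℕ) (lo hi lo' hi' : ℤ)
    (h1 : ∀ z : ℤ, m ≤ z → (z + t) % 2 = 0 → lo ≤ z → lo' ≤ z)
    (h2 : ∀ z : ℤ, z ≤ m + w → z ≤ hi → z ≤ hi') :
    (P 1 p).real (evV 0 m w 0 t lo hi) ≤ (P 1 p).real (evV 0 m w 0 t lo' hi') := by
  refine measureReal_mono ?_
  rintro ω ⟨_, t, v, ⟨rfl, rfl, h3, h4, h5⟩, h⟩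
  have b := h3 t (by omega) le_rfl
  exact ⟨_, _, v, ⟨rfl, rfl, h3, h1 _ b.1 (h.par t (by omega) le_rfl) h4, h2 _ b.2 h5⟩, h⟩

/-- The counting argument. -/
lemma counting (p : ℝ) (w t : ℕ) (hw : 2 ≤ w) (ht : 1 ≤ t) (m A : ℤ) (hm : m = 0 ∨ m = -1)
    (hA : A = -w ∨ A = -w + 1) :
    w * (theta 1 p t ^ 2 * (P 1 p).real (evH 0 A (A + 3 * w) t) *
      (P 1 p).real (evV 0 m w 0 t m (m + w)) ^ 3) ≤ chi 1 p t := by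
  set θ := theta 1 p t with hθ
  set β := (P 1 p).real (evH 0 A (A + 3 * w) t) with hβ
  set v := (P 1 p).real (evV 0 m w 0 t m (m + w)) with hv
  have θ0 : 0 ≤ θ := ENNReal.toReal_nonneg
  have β0 : 0 ≤ β := (real_bounds p _).1
  have v0 : 0 ≤ v := (real_bounds p _).1
  have θS : θ ≤ (P 1 p).real (evS t) := theta_le p t
  obtain ⟨n, hn⟩ : ∃ n : ℕ, w = 2 * (n + 1) ∨ w + 1 = 2 * (n + 1) := ⟨(w + 1) / 2 - 1, by omega⟩
  obtain ⟨l, hl, hlm⟩ : ∃ l : ℤ, (l = -w ∨ l = -w + 1) ∧ (l - m) % 2 = 0 := by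
    by_cases c : (-w - m) % 2 = 0
    · exact ⟨_, Or.inl rfl, c⟩
    · exact ⟨_, Or.inr rfl, by omega⟩
  set c : ℤ := m + 2 * (n + 1) with hc
  -- shifted windows
  have shift : ∀ (m' lo hi : ℤ), (m' - m) % 2 = 0 → (P 1 p).real (evV 0 m w 0 t lo hi) ≤
      (P 1 p).real (evV 0 m' w 0 t (lo + (m' - m)) (hi + (m' - m))) := by
    intro m' lo hi h
    have := evV_shift p 0 m w 0 t lo hi 0 (m - m') 0 (by push_cast; omega)
    rwa [show m - (m - m') = m' by ring, show lo - (m - m') = lo + (m' - m) by ring,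
      show hi - (m - m') = hi + (m' - m) by ring] at this
  have vL : v ≤ (P 1 p).real (evV 0 l w 0 t l (l + w)) := by
    have := shift l m (m + w) hlm
    rwa [show m + (l - m) = l by ring, show m + (w : ℤ) + (l - m) = l + w by ring] at this
  have vc : v ≤ (P 1 p).real (evV 0 c w 0 t c (c + w)) := by
    have := shift c m (m + w) (by omega)
    rwa [show m + (c - m) = c by ring, show m + (w : ℤ) + (c - m) = c + w by ring] at this
  obtain ⟨y0, hy0, hy1⟩ : ∃ y0 : ℤ, (y0 = 0 ∨ y0 = 1) ∧ (m + y0 - t) % 2 = 0 := by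
    by_cases c : (m + 0 - t) % 2 = 0
    · exact ⟨_, Or.inl rfl, c⟩
    · exact ⟨_, Or.inr rfl, by omega⟩
  set X : ℕ → ℤ := fun i => m + y0 + 2 * i with hX
  set T : ℤ → ℝ := fun x => (P 1 p).real (evT x t) with hT
  have f0 : ∀ y : ℤ, 0 ≤ (P 1 p).real (evV 0 m w 0 t (m + y) (m + w)) :=
    fun y => (real_bounds p _).1
  have g0 : ∀ y : ℤ, 0 ≤ (P 1 p).real (evV 0 m w 0 t m (m + y)) :=
    fun y => (real_bounds p _).1
  have right : ∀ y : ℤ, 0 ≤ y → (m + y - t) % 2 = 0 →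
      θ ^ 2 * β * (v * v * (P 1 p).real (evV 0 m w 0 t (m + y) (m + w))) ≤ T (c + y) := by
    intro y y1 y2
    refine six p (lo := m) (hi := c + w) (m := m) (c := c) (by omega) (by omega) (by omega) (by omega)
      (by omega) (by omega) θ0 v0 v0 (f0 y) β0 θS vL ?_ ?_ (le_of_eq hβ)
    · exact evV_mono p m w t _ _ _ _ (fun z _ _ h => h) (fun z h _ => by omega)
    · have := shift c (m + y) (m + w) (by omega)
      rwa [show m + y + (c - m) = c + y by ring, show m + (w : ℤ) + (c - m) = c + w by ring] at this
  have left : ∀ y : ℤ, m + y ≤ c → (m + y - t) % 2 = 0 →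
      θ ^ 2 * β * (v * (P 1 p).real (evV 0 m w 0 t m (m + y)) * v) ≤ T (m + y) := by
    intro y y1 y2
    refine six p (lo := m) (hi := c + w) (m := m) (c := c) (by omega) (by omega) (by omega) (by omega)
      (by omega) (by omega) θ0 v0 (g0 y) v0 β0 θS vL le_rfl ?_ (le_of_eq hβ)
    refine vc.trans (evV_mono p c w t _ _ _ _ (fun z _ _ h => by omega) (fun z h _ => by omega))
  have fg : ∀ y : ℤ, v ≤ (P 1 p).real (evV 0 m w 0 t m (m + y)) +
      (P 1 p).real (evV 0 m w 0 t (m + y) (m + w)) := by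
    intro y
    refine le_trans (measureReal_mono ?_) (measureReal_union_le _ _)
    rintro ω ⟨s', u', z, ⟨hs, hu, h3, h4, h5⟩, h⟩
    rcases le_total (z t) (m + y) with e | e
    · exact Or.inl ⟨s', u', z, ⟨hs, hu, h3, h4, e⟩, h⟩
    · exact Or.inr ⟨s', u', z, ⟨hs, hu, h3, e, h5⟩, h⟩
  set U : ℝ := θ ^ 2 * β * v ^ 3 with hU
  have K0 : 0 ≤ θ ^ 2 * β * (v * v) := by positivity
  have pair : ∀ j ∈ Finset.range n, U ≤ T (X (j + 1)) + T (X (n + (j + 1) + 1)) := by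
    intro j hj
    rw [Finset.mem_range] at hj
    have a := left (y0 + 2 * (j + 1 : ℕ)) (by push_cast; omega) (by omega)
    have b := right (y0 + 2 * (j + 1 : ℕ)) (by omega) (by omega)
    have e1 : m + (y0 + 2 * (j + 1 : ℕ)) = X (j + 1) := by simp only [hX]; ring
    have e2 : c + (y0 + 2 * (j + 1 : ℕ)) = X (n + (j + 1) + 1) := by
      simp only [hX, hc]; push_cast; ring
    have k := mul_le_mul_of_nonneg_left (fg (y0 + 2 * (j + 1 : ℕ))) K0
    rw [e2] at b
    rw [e1] at a b k
    calc U = θ ^ 2 * β * (v * v) * v := by rw [hU]; ring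
      _ ≤ _ := k
      _ ≤ _ := by linarith
  have mid : U ≤ T (X (n + 0 + 1)) := by
    have b := right y0 (by omega) hy1
    have e2 : c + y0 = X (n + 0 + 1) := by
      simp only [hX, hc]; push_cast; ring
    have k : v ≤ (P 1 p).real (evV 0 m w 0 t (m + y0) (m + w)) :=
      evV_mono p m w t _ _ _ _ (fun z _ _ h => by omega) (fun z h _ => by omega)
    have k := mul_le_mul_of_nonneg_left k K0
    rw [e2] at b
    calc U = θ ^ 2 * β * (v * v) * v := by rw [hU]; ring
      _ ≤ _ := k
      _ ≤ _ := by linarith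
  have tot : (n + 1 : ℝ) * U ≤ ∑ j ∈ Finset.range (n + (n + 1)), T (X (j + 1)) := by
    rw [Finset.sum_range_add, Finset.sum_range_succ', ← add_assoc, ← Finset.sum_add_distrib]
    have := Finset.card_nsmul_le_sum (Finset.range n) _ U pair
    rw [Finset.card_range, nsmul_eq_mul] at this
    linarith
  have X1 : ∀ j, 1 ≤ X (j + 1) := by
    intro j; simp only [hX]; push_cast; omega
  have Xinj : Function.Injective fun j => X (j + 1) := by
    intro i j h
    simp only [hX] at h; push_cast at h; omega
  set F := (Finset.range (n + (n + 1))).image (fun j => X (j + 1)) with hF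
  have Fpos : ∀ x ∈ F, 1 ≤ x := by
    intro x hx
    obtain ⟨j, -, rfl⟩ := Finset.mem_image.1 hx
    exact X1 j
  have sF : ∑ x ∈ F, T x = ∑ j ∈ Finset.range (n + (n + 1)), T (X (j + 1)) := by
    rw [hF, Finset.sum_image (fun a _ b _ h => Xinj h)]
  have sN : ∑ x ∈ F, T x ≤ ∑ x ∈ F.image (fun x => -x), T x := by
    rw [Finset.sum_image (fun a _ b _ h => neg_injective h)]
    exact Finset.sum_le_sum fun x _ => evT_refl p x t
  have dis : Disjoint F (F.image (fun x => -x)) := by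
    rw [Finset.disjoint_left]
    intro x hx hx'
    obtain ⟨z, hz, rfl⟩ := Finset.mem_image.1 hx'
    have := Fpos _ hx
    have := Fpos _ hz
    omega
  have fin := le_chi p t ht (F ∪ F.image (fun x => -x))
  rw [Finset.sum_union dis] at fin
  have wn : (w : ℝ) ≤ 2 * (n + 1) := by
    have : w ≤ 2 * (n + 1) := by omega
    exact_mod_cast this
  have U0 : 0 ≤ U := by positivity
  have := mul_le_mul_of_nonneg_right wn U0
  linarith

/-- let `d = 1`, `p = p_c`, `ε ∈ (0,1)`, `t ≥ 1`, and let `w ≥ 2` be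
an integer with `V_{p_c}(w, 3t) ≥ ε` and `H_{p_c}(3w, t) ≥ ε`.  Then
`χ_t ≥ (1/2) ε⁶ w θ_t²`. -/
theorem chi_lower_bound_from_crossings (ε : ℝ) (hε : ε ∈ Set.Ioo (0 : ℝ) 1)
    (t : ℕ) (ht : 1 ≤ t) (w : ℕ) (hw : 2 ≤ w)
    (hV : ε ≤ V (pc 1) w (3 * t)) (hH : ε ≤ H (pc 1) (3 * w) t) :
    1 / 2 * ε ^ 6 * (w : ℝ) * theta 1 (pc 1) t ^ 2 ≤ chi 1 (pc 1) t := by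
  obtain ⟨A, hA, h4⟩ := horiz (pc 1) w t
  obtain ⟨m, hm, h2⟩ := vert (pc 1) w t
  have num := numerics ε _ _ hε.1 hε.2 (h4.trans (by linarith)) (h2.trans (by linarith))
  refine le_trans ?_ (counting (pc 1) w t hw ht m A hm hA)
  have k : 0 ≤ (w : ℝ) * theta 1 (pc 1) t ^ 2 := by positivity
  have := mul_le_mul_of_nonneg_left num k
  linarith

end OrientedPercolation
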